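/- arXiv:1102.2555 — 2 statements merged into one kernel-verified Lean document; each statement's English description precedes it below -/
import Mathlib

section
/- Let a and b be linearly independent unit vectors in a finite-dimensional complex inner product space, let C1, C2 > 0, and let w be a unit eigenvector of T = (1/C1)|a⟩⟨a| − (1/C2)|b⟩⟨b| associated with its unique negative eigenvalue. Setting s = 1 − |⟨a,b⟩|² and D = (C2 − C1)² + 4 C1 C2 s, one has |⟨a,w⟩|² = ½[1 − (C2 − C1 + 2 C1 s)/√D] and |⟨b,w⟩|² = ½[1 − (C2 − C1 − 2 C2 s)/√D]. -/
open scoped InnerProductSpace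

noncomputable section

/-- The rank-one operator `|a⟩⟨a| : x ↦ ⟨a, x⟩ • a`. -/
def rankOne {V : Type*} [NormedAddCommGroup V] [InnerProductSpace ℂ V] (a : V) :
    V →ₗ[ℂ] V :=
  (LinearMap.toSpanSingleton ℂ V a).comp (innerₛₗ ℂ a)

theorem rankOne_apply {V : Type*} [NormedAddCommGroup V] [InnerProductSpace ℂ V] (a x : V) :
    rankOne a x = ⟪a, x⟫_ℂ • a := by
  simp [rankOne]

/-- The negative root `l` of `C1 C2 l² - (C2 - C1) l - s = 0`, rearranged for the square root of
the discriminant. -/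
theorem sqrt_discrim_eq_of_neg_root {C1 C2 l s : ℝ} (hC1 : 0 < C1) (hC2 : 0 < C2) (hl : l < 0)
    (hs : 0 ≤ s) (h : 1 - s = (1 - C1 * l) * (1 + C2 * l)) :
    Real.sqrt ((C2 - C1) ^ 2 + 4 * C1 * C2 * s) = C2 - C1 - 2 * C1 * C2 * l ∧
      0 < C2 - C1 - 2 * C1 * C2 * l := by
  have hCl : C1 * C2 * l < 0 := mul_neg_of_pos_of_neg (mul_pos hC1 hC2) hl
  have hle : 0 ≤ C2 - C1 - C1 * C2 * l := by
    by_contra! hlt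
    nlinarith [mul_pos_of_neg_of_neg hlt hl]
  have hpos : 0 < C2 - C1 - 2 * C1 * C2 * l := by linarith
  refine ⟨?_, hpos⟩
  rw [Real.sqrt_eq_iff_mul_self_eq_of_pos hpos]
  linear_combination (4 * C1 * C2) * h

/-- The weights `p`, `q` of an eigenvector are determined by its negative eigenvalue `l`. -/
theorem weights_of_neg_root {C1 C2 l s p q : ℝ} (hC1 : 0 < C1) (hC2 : 0 < C2) (hl : l < 0)
    (hs : 0 ≤ s) (h : 1 - s = (1 - C1 * l) * (1 + C2 * l))
    (hpq : C2 * p - C1 * q = C1 * C2 * l)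
    (hratio : C1 ^ 2 * ((1 - s) * q) = C2 ^ 2 * ((1 - C1 * l) ^ 2 * p)) :
    p = (1 / 2) * (1 - (C2 - C1 + 2 * C1 * s) / Real.sqrt ((C2 - C1) ^ 2 + 4 * C1 * C2 * s)) ∧
    q = (1 / 2) * (1 - (C2 - C1 - 2 * C2 * s) / Real.sqrt ((C2 - C1) ^ 2 + 4 * C1 * C2 * s)) := by
  obtain ⟨hsqrt, hpos⟩ := sqrt_discrim_eq_of_neg_root hC1 hC2 hl hs h
  have hC1l : 0 < 1 - C1 * l := by nlinarith
  have hcancel : C1 ^ 2 * (1 + C2 * l) * q = C2 ^ 2 * (1 - C1 * l) * p := by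
    apply mul_left_cancel₀ hC1l.ne'
    rw [h] at hratio
    linear_combination hratio
  have hs' : s = 1 - (1 - C1 * l) * (1 + C2 * l) := by linarith
  have hq : q * (C2 - C1 - 2 * C1 * C2 * l) = -C2 ^ 2 * l * (1 - C1 * l) := by
    apply mul_left_cancel₀ hC1.ne'
    linear_combination (-C2 * (1 - C1 * l)) * hpq - hcancel
  have hp : p * (C2 - C1 - 2 * C1 * C2 * l) = -C1 ^ 2 * l * (1 + C2 * l) := by
    apply mul_left_cancel₀ hC2.ne'
    linear_combination (-C1 * (1 + C2 * l)) * hpq - hcancel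
  rw [hsqrt]
  constructor
  · rw [one_sub_div hpos.ne', ← mul_div_assoc, eq_div_iff hpos.ne', hp, hs']
    ring
  · rw [one_sub_div hpos.ne', ← mul_div_assoc, eq_div_iff hpos.ne', hq, hs']
    ring

/-- Let `w` be a unit eigenvector of `T = C1⁻¹ |a⟩⟨a| − C2⁻¹ |b⟩⟨b|` associated with its unique
negative eigenvalue (any negative eigenvalue `lam`).  With `s = 1 − |⟨a,b⟩|²` and
`D = (C2 − C1)² + 4 C1 C2 s`, one has
`|⟨a,w⟩|² = ½ (1 − (C2 − C1 + 2 C1 s)/√D)` and `|⟨b,w⟩|² = ½ (1 − (C2 − C1 − 2 C2 s)/√D)`. -/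
theorem overlaps_with_negative_eigenvector
    {V : Type*} [NormedAddCommGroup V] [InnerProductSpace ℂ V] [FiniteDimensional ℂ V]
    (a b : V) (ha : ‖a‖ = 1) (hb : ‖b‖ = 1) (hab : LinearIndependent ℂ ![a, b])
    (C1 C2 : ℝ) (hC1 : 0 < C1) (hC2 : 0 < C2)
    (w : V) (hw : ‖w‖ = 1) (lam : ℝ) (hlam : lam < 0)
    (heig : (((C1 : ℂ))⁻¹ • rankOne a - ((C2 : ℂ))⁻¹ • rankOne b) w = ((lam : ℝ) : ℂ) • w) :
    let s : ℝ := 1 - ‖⟪a, b⟫_ℂ‖ ^ 2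
    let D : ℝ := (C2 - C1) ^ 2 + 4 * C1 * C2 * s
    ‖⟪a, w⟫_ℂ‖ ^ 2 = (1 / 2) * (1 - (C2 - C1 + 2 * C1 * s) / Real.sqrt D) ∧
    ‖⟪b, w⟫_ℂ‖ ^ 2 = (1 / 2) * (1 - (C2 - C1 - 2 * C2 * s) / Real.sqrt D) := by
  intro s D
  have hC1' : (C1 : ℂ) ≠ 0 := by exact_mod_cast hC1.ne'
  have hC2' : (C2 : ℂ) ≠ 0 := by exact_mod_cast hC2.ne'
  have haa : ⟪a, a⟫_ℂ = 1 := by simp [inner_self_eq_norm_sq_to_K, ha]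
  have hbb : ⟪b, b⟫_ℂ = 1 := by simp [inner_self_eq_norm_sq_to_K, hb]
  have hww : ⟪w, w⟫_ℂ = 1 := by simp [inner_self_eq_norm_sq_to_K, hw]
  have hinner (v : V) : (C2 : ℂ) * (⟪a, w⟫_ℂ * ⟪v, a⟫_ℂ) - C1 * (⟪b, w⟫_ℂ * ⟪v, b⟫_ℂ) =
      C1 * C2 * lam * ⟪v, w⟫_ℂ := by
    have := congrArg (fun x => ⟪v, x⟫_ℂ) heig
    simp only [LinearMap.sub_apply, LinearMap.smul_apply, rankOne_apply, inner_sub_right,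
      inner_smul_right] at this
    field_simp at this
    linear_combination this
  have hconj (v u : V) : ⟪v, u⟫_ℂ * ⟪u, v⟫_ℂ = ((‖⟪v, u⟫_ℂ‖ ^ 2 : ℝ) : ℂ) := by
    rw [← inner_conj_symm u v, Complex.mul_conj']
    norm_cast
  have hEa := hinner a
  have hEb := hinner b
  have hEw := hinner w
  rw [haa] at hEa
  rw [hbb] at hEb
  rw [hww, hconj, hconj] at hEw
  have hpq : C2 * ‖⟪a, w⟫_ℂ‖ ^ 2 - C1 * ‖⟪b, w⟫_ℂ‖ ^ 2 = C1 * C2 * lam := by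
    rw [mul_one] at hEw
    exact_mod_cast hEw
  have hbw : ⟪b, w⟫_ℂ ≠ 0 := by
    intro h0
    rw [h0, norm_zero] at hpq
    nlinarith [mul_neg_of_pos_of_neg (mul_pos hC1 hC2) hlam, sq_nonneg ‖⟪a, w⟫_ℂ‖]
  have hchar : 1 - s = (1 - C1 * lam) * (1 + C2 * lam) := by
    have : ((‖⟪a, b⟫_ℂ‖ ^ 2 : ℝ) : ℂ) = (1 - C1 * lam) * (1 + C2 * lam) := by
      rw [← hconj]
      apply mul_left_cancel₀ (mul_ne_zero hC1' hbw)
      linear_combination (-⟪b, a⟫_ℂ) * hEa + (1 - C1 * lam : ℂ) * hEb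
    have hreal : ‖⟪a, b⟫_ℂ‖ ^ 2 = (1 - C1 * lam) * (1 + C2 * lam) := by exact_mod_cast this
    rw [← hreal]
    ring
  have hratio : C1 ^ 2 * ((1 - s) * ‖⟪b, w⟫_ℂ‖ ^ 2) =
      C2 ^ 2 * ((1 - C1 * lam) ^ 2 * ‖⟪a, w⟫_ℂ‖ ^ 2) := by
    have hE : (C1 : ℂ) * (⟪b, w⟫_ℂ * ⟪a, b⟫_ℂ) = C2 * (((1 - C1 * lam : ℝ) : ℂ) * ⟪a, w⟫_ℂ) := by
      push_cast
      linear_combination -hEa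
    have hnorm := congrArg (fun z : ℂ => ‖z‖ ^ 2) hE
    simp only [norm_mul, Complex.norm_real, mul_pow, Real.norm_eq_abs, sq_abs] at hnorm
    rw [← hnorm]
    ring
  have hs : 0 ≤ s := by
    have hle := norm_inner_le_norm (𝕜 := ℂ) a b
    rw [ha, hb, one_mul] at hle
    exact sub_nonneg.2 (pow_le_one₀ (norm_nonneg _) hle)
  exact weights_of_neg_root hC1 hC2 hlam hs hchar hpq hratio

end
end

section
/- Fix q ∈ (0,1). With γ1(α) = [q(α−1) + √(q²(α−1)² + 4qα)]/2 and β1(α) = [(2α+1) − √((2α+1)² − 4(α² − α·γ1(α)))]/2, one has, as α → ∞, h(β1(α), γ1(α)) = −log q − (1−q)/(q(α−1)+2) + O(1/α²); that is, the function α ↦ α²·( h(β1(α), γ1(α)) + log q + (1−q)/(q(α−1)+2) ) is bounded as α → ∞. -/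
noncomputable section

/-- The exponent function `h(β,γ)` (for parameters `α` and `q`). -/
def hfun (α q β γ : ℝ) : ℝ :=
  (α - β - γ) * Real.log (α - β - γ) - (1 + α - β + γ) * Real.log (1 + α - β + γ)
    + (α - β) * Real.log (α - β) - (1 + α - β) * Real.log (1 + α - β)
    - 3 * α * Real.log α + (1 + α) * Real.log (1 + α)
    + β * Real.log β + (1 + 2 * α - β) * Real.log (1 + 2 * α - β)
    + 2 * γ * Real.log γ - γ * Real.log q - (α - γ) * Real.log (1 - q)

/-- `γ1(α) = (q(α−1) + √(q²(α−1)² + 4qα))/2`. -/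
def gamma1 (α q : ℝ) : ℝ :=
  (q * (α - 1) + Real.sqrt (q ^ 2 * (α - 1) ^ 2 + 4 * q * α)) / 2

/-- `β1(α) = ((2α+1) − √((2α+1)² − 4(α² − α γ1(α))))/2`. -/
def beta1 (α q : ℝ) : ℝ :=
  ((2 * α + 1) - Real.sqrt ((2 * α + 1) ^ 2 - 4 * (α ^ 2 - α * gamma1 α q))) / 2

open Filter Asymptotics

/-- The logarithm of a quotient identity `a * b = c * d` between positive reals. -/
theorem log_add_log_eq_of_mul_eq_mul {a b c d : ℝ} (ha : 0 < a) (hb : 0 < b) (hc : 0 < c)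
    (hd : 0 < d) (h : a * b = c * d) :
    Real.log a + Real.log b = Real.log c + Real.log d := by
  rw [← Real.log_mul ha.ne' hb.ne', ← Real.log_mul hc.ne' hd.ne', h]

theorem gamma1_pos {α q : ℝ} (hα : 0 < α) (hq : 0 < q) : 0 < gamma1 α q := by
  have h : |q * (α - 1)| < Real.sqrt (q ^ 2 * (α - 1) ^ 2 + 4 * q * α) := by
    rw [← Real.sqrt_sq_eq_abs]
    apply Real.sqrt_lt_sqrt (sq_nonneg _)
    nlinarith [mul_pos hq hα]
  have := neg_abs_le (q * (α - 1))
  unfold gamma1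
  linarith

theorem gamma1_sq {α q : ℝ} (hα : 0 < α) (hq : 0 < q) :
    gamma1 α q ^ 2 = q * (α - 1) * gamma1 α q + q * α := by
  have h := Real.sq_sqrt (show 0 ≤ q ^ 2 * (α - 1) ^ 2 + 4 * q * α by positivity)
  unfold gamma1
  linear_combination h / 4

/-- The value of `h` at a point `(α - x, γ)` satisfying the critical equations. -/
theorem hfun_of_critical {α q γ x : ℝ} (hα : 0 < α) (hq : q ∈ Set.Ioo (0 : ℝ) 1) (hγ : 0 < γ)
    (hγ_eq : γ ^ 2 = q * (α - 1) * γ + q * α) (hx : 0 < x) (hx_eq : x ^ 2 + x = α * (1 + γ)) :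
    hfun α q (α - x) γ =
      α * Real.log ((α - γ) * (1 + α) / ((1 - q) * α ^ 2))
        + Real.log ((1 + α) / (1 + γ)) := by
  obtain ⟨hq0, hq1⟩ := hq
  have hp : 0 < 1 - q := sub_pos.2 hq1
  have hγγ : γ * γ * (1 - q) = q * ((1 + γ) * (α - γ)) := by linear_combination hγ_eq
  have hαγ : 0 < α - γ := by
    have h : 0 < q * (1 + γ) * (α - γ) := by
      rw [mul_assoc, ← hγγ]
      positivity
    exact pos_of_mul_pos_right h (by positivity)
  have hAB : (x - γ) * (1 + x + γ) = (1 + γ) * (α - γ) := by linear_combination hx_eq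
  have hA : 0 < x - γ := by
    have h : 0 < (x - γ) * (1 + x + γ) := by
      rw [hAB]
      positivity
    exact pos_of_mul_pos_left h (by positivity)
  have hβ_eq : (1 + γ) * (α - x) = x * (x - γ) := by linear_combination -hx_eq
  have hβ : 0 < α - x := by
    have h : 0 < (1 + γ) * (α - x) := by
      rw [hβ_eq]
      positivity
    exact pos_of_mul_pos_right h (by positivity)
  have l1 := log_add_log_eq_of_mul_eq_mul hA (show 0 < 1 + x + γ by positivity)
    (show 0 < 1 + γ by positivity) hαγ hAB
  have l2 := log_add_log_eq_of_mul_eq_mul hx (show 0 < 1 + x by positivity) hα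
    (show 0 < 1 + γ by positivity) (by linear_combination hx_eq)
  have l3 := log_add_log_eq_of_mul_eq_mul (show 0 < 1 + γ by positivity)
    (show 0 < 1 + α + x by positivity) (show 0 < 1 + x by positivity)
    (show 0 < 1 + x + γ by positivity) (by linear_combination -hx_eq)
  have l4 := log_add_log_eq_of_mul_eq_mul (mul_pos hγ hγ) hp hq0
    (mul_pos (show 0 < 1 + γ by positivity) hαγ) hγγ
  rw [Real.log_mul hγ.ne' hγ.ne', Real.log_mul (by positivity) hαγ.ne'] at l4
  have l5 := log_add_log_eq_of_mul_eq_mul (show 0 < 1 + γ by positivity) hβ hx hA hβ_eq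
  have hR : Real.log ((α - γ) * (1 + α) / ((1 - q) * α ^ 2)) =
      Real.log (α - γ) + Real.log (1 + α) - (Real.log (1 - q) + 2 * Real.log α) := by
    rw [Real.log_div (by positivity) (by positivity), Real.log_mul hαγ.ne' (by positivity),
      Real.log_mul hp.ne' (by positivity), Real.log_pow]
    norm_num
  rw [hR, Real.log_div (by positivity) (by positivity)]
  unfold hfun
  rw [show α - (α - x) - γ = x - γ by ring, show 1 + α - (α - x) + γ = 1 + x + γ by ring,
    show 1 + α - (α - x) = 1 + x by ring, show α - (α - x) = x by ring,
    show 1 + 2 * α - (α - x) = 1 + α + x by ring]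
  have e1 : Real.log (x - γ) =
    Real.log (1 + γ) + Real.log (α - γ) - Real.log (1 + x + γ) := by linarith
  have e2 : Real.log x = Real.log α + Real.log (1 + γ) - Real.log (1 + x) := by linarith
  have e3 : Real.log (1 + α + x) =
    Real.log (1 + x) + Real.log (1 + x + γ) - Real.log (1 + γ) := by linarith
  have e4 : Real.log γ =
    (Real.log q + Real.log (1 + γ) + Real.log (α - γ) - Real.log (1 - q)) / 2 := by linarith
  have e5 : Real.log (α - x) = Real.log x + Real.log (x - γ) - Real.log (1 + γ) := by linarith
  rw [e5, e1, e2, e3, e4]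
  ring

theorem hfun_beta1_gamma1 {α q : ℝ} (hα : 0 < α) (hq : q ∈ Set.Ioo (0 : ℝ) 1) :
    hfun α q (beta1 α q) (gamma1 α q) =
      α * Real.log ((α - gamma1 α q) * (1 + α) / ((1 - q) * α ^ 2))
        + Real.log ((1 + α) / (1 + gamma1 α q)) := by
  have hγ := gamma1_pos hα hq.1
  set γ := gamma1 α q with hγ_def
  set s := Real.sqrt (1 + 4 * (α * (1 + γ))) with hs_def
  have hs : s ^ 2 = 1 + 4 * (α * (1 + γ)) := Real.sq_sqrt (by positivity)
  have hs1 : 1 < s := by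
    rw [hs_def, Real.lt_sqrt zero_le_one]
    nlinarith [mul_pos hα hγ]
  have hβ : beta1 α q = α - (s - 1) / 2 := by
    rw [beta1, ← hγ_def, hs_def,
      show (2 * α + 1) ^ 2 - 4 * (α ^ 2 - α * γ) = 1 + 4 * (α * (1 + γ)) by ring]
    ring
  rw [hβ]
  exact hfun_of_critical hα hq hγ (gamma1_sq hα hq.1) (by linarith)
    (by linear_combination hs / 4)

theorem Real.abs_log_one_add_sub_self_le {u : ℝ} (hu : |u| ≤ 1 / 2) :
    |Real.log (1 + u) - u| ≤ 2 * u ^ 2 := by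
  obtain ⟨h1, h2⟩ := abs_le.1 hu
  have hpos : 0 < 1 + u := by linarith
  have hlow := Real.one_sub_inv_le_log_of_pos hpos
  have hup := Real.log_le_sub_one_of_pos hpos
  have hinv : 1 - (1 + u)⁻¹ - u = -(u ^ 2 / (1 + u)) := by
    field_simp
    ring
  have hsq : u ^ 2 / (1 + u) ≤ 2 * u ^ 2 := by
    rw [div_le_iff₀ hpos]
    nlinarith [sq_nonneg u]
  rw [abs_le]
  constructor <;> nlinarith [sq_nonneg u]

theorem Real.isBigO_log_one_add_sub_self {ι : Type*} {l : Filter ι} {u : ι → ℝ}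
    (hu : Tendsto u l (nhds 0)) :
    (fun i => Real.log (1 + u i) - u i) =O[l] fun i => u i ^ 2 := by
  refine IsBigO.of_bound 2 ?_
  have h : ∀ᶠ i in l, |u i| ≤ 1 / 2 := by
    have := hu.abs
    rw [abs_zero] at this
    exact this.eventually_le_const (by norm_num)
  filter_upwards [h] with i hi
  rw [Real.norm_eq_abs, Real.norm_eq_abs, abs_of_nonneg (sq_nonneg (u i))]
  exact Real.abs_log_one_add_sub_self_le hi

/-- A function eventually at least `c * α` with `c > 0` has inverse `O(1/α)`. -/
theorem isBigO_inv_of_eventually_const_mul_le {f : ℝ → ℝ} {c : ℝ} (hc : 0 < c)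
    (hf : ∀ᶠ α in atTop, c * α ≤ f α) :
    (fun α => (f α)⁻¹) =O[atTop] fun α : ℝ => α⁻¹ := by
  refine IsBigO.of_bound c⁻¹ ?_
  filter_upwards [hf, eventually_gt_atTop 0] with α h hα
  have hcα : 0 < c * α := mul_pos hc hα
  rw [Real.norm_of_nonneg (inv_nonneg.2 (hcα.le.trans h)), Real.norm_of_nonneg (by positivity),
    ← mul_inv]
  exact inv_anti₀ hcα h

/-- Asymptotics of the reduced critical value, along any positive solution `γ` of the quadratic
equation defining `gamma1`. -/
theorem isBigO_critical_value {q : ℝ} (hq : q ∈ Set.Ioo (0 : ℝ) 1) {γ : ℝ → ℝ}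
    (hγ : ∀ᶠ α in atTop, 0 < γ α)
    (hγ_eq : ∀ᶠ α in atTop, γ α ^ 2 = q * (α - 1) * γ α + q * α) :
    (fun α => α * Real.log ((α - γ α) * (1 + α) / ((1 - q) * α ^ 2))
        + Real.log ((1 + α) / (1 + γ α)) + Real.log q + (1 - q) / (q * (α - 1) + 2))
      =O[atTop] fun α : ℝ => α⁻¹ ^ 2 := by
  obtain ⟨hq0, hq1⟩ := hq
  have hp : 0 < 1 - q := sub_pos.2 hq1
  have hγ_gt : ∀ᶠ α in atTop, q * (α - 1) < γ α := by
    filter_upwards [hγ, hγ_eq, eventually_gt_atTop 0] with α h1 h2 hα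
    have := mul_pos hq0 hα
    nlinarith
  have hinv : Tendsto (fun α : ℝ => α⁻¹) atTop (nhds 0) := tendsto_inv_atTop_zero
  have hinv1 : (fun α : ℝ => α⁻¹) =O[atTop] fun _ => (1 : ℝ) := hinv.isBigO_one ℝ
  have hconst (c : ℝ) : (fun _ : ℝ => c) =O[atTop] fun _ => (1 : ℝ) := isBigO_const_one ℝ c _
  have hγ_inv : (fun α => (γ α)⁻¹) =O[atTop] fun α : ℝ => α⁻¹ := by
    refine isBigO_inv_of_eventually_const_mul_le (half_pos hq0) ?_
    filter_upwards [hγ_gt, eventually_ge_atTop 2] with α h hα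
    nlinarith
  have hγ_inv' : (fun α => (1 + γ α)⁻¹) =O[atTop] fun α : ℝ => α⁻¹ := by
    refine isBigO_inv_of_eventually_const_mul_le hq0 ?_
    filter_upwards [hγ_gt] with α h
    linarith
  have hD_inv : (fun α => (q * (α - 1) + 2)⁻¹) =O[atTop] fun α : ℝ => α⁻¹ := by
    refine isBigO_inv_of_eventually_const_mul_le hq0 (Eventually.of_forall fun α => ?_)
    linarith
  -- `δ` is the defect in `γ α ≈ q * (α - 1) + 1`.
  set δ : ℝ → ℝ := fun α => q * (α - 1) + 1 - γ α with hδ_def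
  have hγδ : ∀ᶠ α in atTop, δ α * γ α = γ α - q * α := by
    filter_upwards [hγ_eq] with α h
    linear_combination -h
  have hδ1 : δ =O[atTop] fun _ => (1 : ℝ) := by
    have h : (fun α => 1 - q * (α * (γ α)⁻¹)) =O[atTop] fun _ => (1 : ℝ) := by
      refine (hconst 1).sub (IsBigO.const_mul_left ?_ q)
      refine ((isBigO_refl (fun α : ℝ => α) atTop).mul hγ_inv).trans_eventuallyEq ?_
      filter_upwards [eventually_ne_atTop 0] with α hα
      exact mul_inv_cancel₀ hα
    refine EventuallyEq.trans_isBigO ?_ h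
    filter_upwards [hγδ, hγ] with α h hpos
    field_simp
    linear_combination h
  have hδ : δ =O[atTop] fun α : ℝ => α⁻¹ := by
    have h := ((hconst (1 - q)).sub hδ1).mul hγ_inv
    simp only [one_mul] at h
    refine EventuallyEq.trans_isBigO ?_ h
    filter_upwards [hγδ, hγ] with α h hpos
    field_simp
    rw [h, hδ_def]
    ring
  have hρ : (fun α => δ α - (1 - q) / q * α⁻¹) =O[atTop] fun α : ℝ => α⁻¹ ^ 2 := by
    have h := ((hδ.add ((((hconst (1 - q)).sub hδ1).const_mul_left ((1 - q) / q)).mul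
      (isBigO_refl (fun α : ℝ => α⁻¹) atTop) |>.congr_right fun _ => one_mul _)).neg_left).mul
        hγ_inv
    refine EventuallyEq.trans_isBigO ?_ (h.congr_right fun _ => (sq _).symm)
    filter_upwards [hγδ, hγ, eventually_gt_atTop 0] with α h hpos hα
    have hγα : γ α = q * (α - 1) + 1 - δ α := by rw [hδ_def]; ring
    field_simp
    linear_combination (q * α) * h - (1 - q) * hγα
  set t : ℝ → ℝ := fun α => -α⁻¹ ^ 2 + (1 - q)⁻¹ * (δ α * (α⁻¹ + α⁻¹ ^ 2)) with ht_def
  set u : ℝ → ℝ := fun α => (-2 * (1 - q) + δ α) * (1 + γ α)⁻¹ with hu_def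
  have hsq_le : (fun α : ℝ => α⁻¹ ^ 2) =O[atTop] fun α : ℝ => α⁻¹ :=
    (hinv1.mul (isBigO_refl (fun α : ℝ => α⁻¹) atTop)).congr (fun _ => (sq _).symm)
      fun _ => one_mul _
  have ht : t =O[atTop] fun α : ℝ => α⁻¹ ^ 2 :=
    (isBigO_refl (fun α : ℝ => α⁻¹ ^ 2) atTop).neg_left.add
      (((hδ.mul ((isBigO_refl (fun α : ℝ => α⁻¹) atTop).add hsq_le)).congr_right
        fun _ => (sq _).symm).const_mul_left _)
  have hu : u =O[atTop] fun α : ℝ => α⁻¹ :=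
    (((hconst _).add hδ1).mul hγ_inv').congr_right fun _ => one_mul _
  have ht_log : (fun α => α * (Real.log (1 + t α) - t α)) =O[atTop] fun α : ℝ => α⁻¹ ^ 2 := by
    have h := (isBigO_refl (fun α : ℝ => α) atTop).mul
      ((Real.isBigO_log_one_add_sub_self ((ht.trans hsq_le).trans_tendsto hinv)).trans (ht.pow 2))
    refine (h.trans_eventuallyEq (g₂ := fun α : ℝ => α⁻¹ * α⁻¹ ^ 2) ?_).trans
      ((hinv1.mul (isBigO_refl (fun α : ℝ => α⁻¹ ^ 2) atTop)).congr_right fun _ => one_mul _)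
    filter_upwards [eventually_ne_atTop 0] with α hα
    field_simp
  have hu_log : (fun α => Real.log (1 + u α) - u α) =O[atTop] fun α : ℝ => α⁻¹ ^ 2 :=
    (Real.isBigO_log_one_add_sub_self (hu.trans_tendsto hinv)).trans (hu.pow 2)
  have ht_main : (fun α => α⁻¹ ^ 2 * q⁻¹ + (1 - q)⁻¹ * ((δ α - (1 - q) / q * α⁻¹) * (1 + α⁻¹)))
      =O[atTop] fun α : ℝ => α⁻¹ ^ 2 :=
    (((isBigO_refl (fun α : ℝ => α⁻¹ ^ 2) atTop).mul (hconst q⁻¹)).congr_right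
      fun _ => mul_one _).add
      (((hρ.mul ((hconst 1).add hinv1)).congr_right fun _ => mul_one _).const_mul_left _)
  have hu_main : (fun α => δ α * (1 - 2 * (1 - q) * (q * (α - 1) + 2)⁻¹) * (1 + γ α)⁻¹)
      =O[atTop] fun α : ℝ => α⁻¹ ^ 2 :=
    ((hδ.mul ((hconst 1).sub ((hD_inv.trans hinv1).const_mul_left _))).mul hγ_inv').congr_right
      fun _ => by ring
  have hD_main : (fun α => (1 - q) * (2 - q) / q * (α⁻¹ * (q * (α - 1) + 2)⁻¹))
      =O[atTop] fun α : ℝ => α⁻¹ ^ 2 :=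
    (((isBigO_refl (fun α : ℝ => α⁻¹) atTop).mul hD_inv).congr_right
      fun _ => (sq _).symm).const_mul_left _
  refine EventuallyEq.trans_isBigO ?_
    ((((ht_log.add hu_log).add ht_main).add hu_main).add hD_main)
  filter_upwards [hγ, eventually_gt_atTop 1] with α hpos hα
  have hα0 : 0 < α := by linarith
  have hD : 0 < q * (α - 1) + 2 := by nlinarith
  have hγα : γ α = q * (α - 1) + 1 - δ α := by rw [hδ_def]; ring
  have hR : (α - γ α) * (1 + α) / ((1 - q) * α ^ 2) = 1 + t α := by
    simp only [ht_def]
    rw [hγα]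
    field_simp
    ring
  have hS : Real.log ((1 + α) / (1 + γ α)) + Real.log q = Real.log (1 + u α) := by
    rw [← Real.log_mul (by positivity) hq0.ne']
    congr 1
    simp only [hu_def]
    field_simp
    rw [hγα]
    ring
  have ht_eq : α * t α = (1 - q) / q * α⁻¹ + (α⁻¹ ^ 2 * q⁻¹
      + (1 - q)⁻¹ * ((δ α - (1 - q) / q * α⁻¹) * (1 + α⁻¹))) := by
    simp only [ht_def]
    field_simp
    ring
  have hu_eq : u α = -2 * (1 - q) / (q * (α - 1) + 2)
      + δ α * (1 - 2 * (1 - q) * (q * (α - 1) + 2)⁻¹) * (1 + γ α)⁻¹ := by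
    simp only [hu_def]
    field_simp
    rw [hγα]
    ring
  have hD_eq : (1 - q) / q * α⁻¹ = (1 - q) / (q * (α - 1) + 2)
      + (1 - q) * (2 - q) / q * (α⁻¹ * (q * (α - 1) + 2)⁻¹) := by
    field_simp
    ring
  rw [hR]
  linear_combination hS + ht_eq + hu_eq + hD_eq

/-- As `α → ∞`, `h(β1(α), γ1(α)) = −log q − (1−q)/(q(α−1)+2) + O(1/α²)`; i.e. the function
`α ↦ α²·(h(β1(α), γ1(α)) + log q + (1−q)/(q(α−1)+2))` is bounded as `α → ∞`. -/
theorem hfun_critical_value_asymptotic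
    (q : ℝ) (hq : q ∈ Set.Ioo (0 : ℝ) 1) :
    ∃ C : ℝ, ∀ᶠ α : ℝ in Filter.atTop,
      |α ^ 2 * (hfun α q (beta1 α q) (gamma1 α q) + Real.log q
        + (1 - q) / (q * (α - 1) + 2))| ≤ C := by
  have h := isBigO_critical_value hq (γ := fun α => gamma1 α q)
    ((eventually_gt_atTop 0).mono fun α hα => gamma1_pos hα hq.1)
    ((eventually_gt_atTop 0).mono fun α hα => gamma1_sq hα hq.1)
  obtain ⟨C, hC⟩ := h.bound
  refine ⟨C, ?_⟩
  filter_upwards [hC, eventually_gt_atTop 0] with α h hα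
  rw [hfun_beta1_gamma1 hα hq, abs_mul, abs_of_nonneg (sq_nonneg α)]
  rw [Real.norm_eq_abs, Real.norm_of_nonneg (sq_nonneg α⁻¹), inv_pow, ← div_eq_mul_inv,
    le_div_iff₀ (by positivity)] at h
  linarith

end
end
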